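/- arXiv:0805.3981 — 7 statements merged into one kernel-verified Lean document; each statement's English description precedes it below -/
import Mathlib

section
/- The function G(z) = (B1(1 − B2)/(B1 − B2))·z^{B1−1} + ((B1 − 1)B2/(B1 − B2))·z^{B2−1} is strictly increasing on (0, ∞), tends to −∞ as z → 0⁺, and satisfies G(1) = 1; consequently, there exists a unique z ∈ (0, 1) such that G(z) = c/(c + rL). -/
/-- G(z) = (B1(1−B2)/(B1−B2))·z^{B1−1} + ((B1−1)B2/(B1−B2))·z^{B2−1}
is strictly increasing on (0,∞), tends to −∞ as z → 0⁺, satisfies G(1) = 1,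
and there is a unique z ∈ (0,1) with G(z) = c/(c + rL). -/
theorem stmt_4 (B1 B2 c r L : ℝ) (hB1 : 1 < B1) (hB2 : B2 < 0)
    (hc : 0 < c) (hr : 0 < r) (hL : 0 < L)
    (G : ℝ → ℝ)
    (hG : G = fun z : ℝ =>
      (B1 * (1 - B2) / (B1 - B2)) * z ^ (B1 - 1) + ((B1 - 1) * B2 / (B1 - B2)) * z ^ (B2 - 1)) :
    StrictMonoOn G (Set.Ioi (0:ℝ)) ∧
    Filter.Tendsto G (nhdsWithin 0 (Set.Ioi (0:ℝ))) Filter.atBot ∧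
    G 1 = 1 ∧
    (∃! z : ℝ, z ∈ Set.Ioo (0:ℝ) 1 ∧ G z = c / (c + r * L)) := by
  have hD : 0 < B1 - B2 := by linarith
  have ha : 0 < B1 * (1 - B2) / (B1 - B2) :=
    div_pos (mul_pos (by linarith) (by linarith)) hD
  have hb : (B1 - 1) * B2 / (B1 - B2) < 0 :=
    div_neg_of_neg_of_pos (mul_neg_of_pos_of_neg (by linarith) hB2) hD
  have hmono : StrictMonoOn G (Set.Ioi (0:ℝ)) := by
    intro x hx y _ hxy
    rw [hG]
    exact add_lt_add
      (mul_lt_mul_of_pos_left (Real.rpow_lt_rpow (le_of_lt hx) hxy (by linarith)) ha)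
      (mul_lt_mul_of_neg_left (Real.rpow_lt_rpow_of_neg hx hxy (by linarith)) hb)
  have hlim : Filter.Tendsto G (nhdsWithin 0 (Set.Ioi (0:ℝ))) Filter.atBot := by
    rw [hG]
    have h1 : Filter.Tendsto (fun z : ℝ => z ^ (B1 - 1)) (nhdsWithin 0 (Set.Ioi (0:ℝ)))
        (nhds ((0:ℝ) ^ (B1 - 1))) :=
      (Real.continuousAt_rpow_const 0 (B1 - 1) (Or.inr (by linarith))).tendsto.mono_left
        nhdsWithin_le_nhds
    have h2 : Filter.Tendsto (fun z : ℝ => z ^ (B2 - 1)) (nhdsWithin 0 (Set.Ioi (0:ℝ)))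
        Filter.atTop := tendsto_rpow_neg_nhdsGT_zero (by linarith)
    exact (h1.const_mul _).add_atBot (h2.const_mul_atTop_of_neg hb)
  have hone : G 1 = 1 := by
    rw [hG]
    simp only [Real.one_rpow, mul_one]
    rw [← add_div, div_eq_one_iff_eq hD.ne']
    ring
  refine ⟨hmono, hlim, hone, ?_⟩
  have hrL : 0 < r * L := mul_pos hr hL
  have hlt : c / (c + r * L) < 1 := (div_lt_one (by linarith)).2 (by linarith)
  obtain ⟨a, haG, ha0, ha1⟩ : ∃ a, G a < c / (c + r * L) ∧ 0 < a ∧ a < 1 :=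
    ((hlim.eventually_lt_atBot _).and (Ioo_mem_nhdsGT one_pos)).exists
  have hcont : ContinuousOn G (Set.Icc a 1) := by
    rw [hG]
    have hne : ∀ x ∈ Set.Icc a 1, x ≠ 0 := fun x hx => (ha0.trans_le hx.1).ne'
    exact (continuousOn_const.mul (continuousOn_id.rpow_const fun x hx => Or.inl (hne x hx))).add
      (continuousOn_const.mul (continuousOn_id.rpow_const fun x hx => Or.inl (hne x hx)))
  obtain ⟨z, hz, hGz⟩ := intermediate_value_Ioo ha1.le hcont ⟨haG, hone.symm ▸ hlt⟩
  have hz0 : 0 < z := ha0.trans hz.1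
  exact ⟨z, ⟨⟨hz0, hz.2⟩, hGz⟩, fun y hy =>
    hmono.injOn (Set.mem_Ioi.2 hy.1.1) (Set.mem_Ioi.2 hz0) (hy.2.trans hGz.symm)⟩
end

section
/- The function m̂(y) = y·[c/r − ((1 − B2)/(B1 − B2))·(c/r + L)·(y/y_L)^{B1−1} − ((B1 − 1)/(B1 − B2))·(c/r + L)·(y/y_L)^{B2−1}] + 1/λ has second derivative m̂''(y) = −(1/y_L)·((B1 − 1)(1 − B2)/(B1 − B2))·(c/r + L)·(B1·(y/y_L)^{B1−2} − B2·(y/y_L)^{B2−2}), and m̂''(y) < 0 for every y > 0. -/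
theorem hasDerivAt_div_const_rpow {y k : ℝ} (hy : 0 < y) (hk : 0 < k) (s : ℝ) :
    HasDerivAt (fun x : ℝ => (x / k) ^ s) (s / k * (y / k) ^ (s - 1)) y := by
  have h := ((hasDerivAt_id y).div_const k).rpow_const (p := s) (Or.inl (div_pos hy hk).ne')
  refine h.congr_deriv ?_
  simp only [id_eq]
  ring

theorem hasDerivAt_mul_sub_div_const_rpow {y k : ℝ} (hy : 0 < y) (hk : 0 < k)
    (a p q s t d : ℝ) :
    HasDerivAt (fun x : ℝ => x * (a - p * (x / k) ^ s - q * (x / k) ^ t) + d)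
      (a - p * (s + 1) * (y / k) ^ s - q * (t + 1) * (y / k) ^ t) y := by
  have h := ((hasDerivAt_id y).mul
    ((((hasDerivAt_div_const_rpow hy hk s).const_mul p).const_sub a).sub
      ((hasDerivAt_div_const_rpow hy hk t).const_mul q))).add_const d
  refine h.congr_deriv ?_
  have hyk : 0 < y / k := div_pos hy hk
  have rpow_eq (e : ℝ) : (y / k) ^ e = (y / k) ^ (e - 1) * (y / k) := by
    rw [← Real.rpow_add_one hyk.ne', sub_add_cancel]
  simp only [id, Pi.sub_apply]
  rw [rpow_eq s, rpow_eq t]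
  ring


/-- The second derivative of m̂ equals the stated formula and is negative
for every y > 0. -/
theorem stmt_5 (B1 B2 c r lam L yL : ℝ) (hB1 : 1 < B1) (hB2 : B2 < 0)
    (hc : 0 < c) (hr : 0 < r) (hlam : 0 < lam) (hL : 0 < L) (hyL : 0 < yL)
    (mhat : ℝ → ℝ)
    (hmhat : mhat = fun y : ℝ =>
      y * (c/r - ((1 - B2)/(B1 - B2)) * (c/r + L) * (y/yL) ^ (B1 - 1)
             - ((B1 - 1)/(B1 - B2)) * (c/r + L) * (y/yL) ^ (B2 - 1)) + 1/lam) :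
    ∀ y : ℝ, 0 < y →
      deriv (deriv mhat) y
        = -(1/yL) * ((B1 - 1) * (1 - B2) / (B1 - B2)) * (c/r + L)
            * (B1 * (y/yL) ^ (B1 - 2) - B2 * (y/yL) ^ (B2 - 2)) ∧
      deriv (deriv mhat) y < 0 := by
  intro y hy
  have hderiv : deriv (deriv mhat) y
      = -(1/yL) * ((B1 - 1) * (1 - B2) / (B1 - B2)) * (c/r + L)
          * (B1 * (y/yL) ^ (B1 - 2) - B2 * (y/yL) ^ (B2 - 2)) := by
    have hfirst : deriv mhat =ᶠ[nhds y] fun x =>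
        c/r - (1 - B2)/(B1 - B2) * (c/r + L) * (B1 - 1 + 1) * (x/yL) ^ (B1 - 1)
          - (B1 - 1)/(B1 - B2) * (c/r + L) * (B2 - 1 + 1) * (x/yL) ^ (B2 - 1) := by
      filter_upwards [lt_mem_nhds hy] with x hx
      rw [hmhat]
      exact (hasDerivAt_mul_sub_div_const_rpow hx hyL _ _ _ _ _ _).deriv
    rw [hfirst.deriv_eq]
    refine ((((hasDerivAt_div_const_rpow hy hyL (B1 - 1)).const_mul _).const_sub _).sub
      ((hasDerivAt_div_const_rpow hy hyL (B2 - 1)).const_mul _)).deriv.trans ?_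
    rw [show B1 - 1 - 1 = B1 - 2 by ring, show B2 - 1 - 1 = B2 - 2 by ring]
    ring
  refine ⟨hderiv, ?_⟩
  rw [hderiv]
  have hcoef : 0 < 1/yL * ((B1 - 1) * (1 - B2) / (B1 - B2)) * (c/r + L) := by
    have h1 : 0 < B1 - 1 := by linarith
    have h2 : 0 < 1 - B2 := by linarith
    have h3 : 0 < B1 - B2 := by linarith
    positivity
  have hpowers : 0 < B1 * (y/yL) ^ (B1 - 2) - B2 * (y/yL) ^ (B2 - 2) := by
    have h1 : 0 < B1 * (y/yL) ^ (B1 - 2) := by positivity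
    have h2 : B2 * (y/yL) ^ (B2 - 2) < 0 := mul_neg_of_neg_of_pos hB2 (by positivity)
    linarith
  linarith [mul_pos hcoef hpowers]
end

section
/- The function m̂ defined on [0, y_L] by m̂(y) = (c/r)·y·(1 − (1/B1)·(y/y₀)^{B1−1}) for 0 ≤ y ≤ y₀ and m̂(y) = y·[c/r − ((1 − B2)/(B1 − B2))·(c/r + L)·(y/y_L)^{B1−1} − ((B1 − 1)/(B1 − B2))·(c/r + L)·(y/y_L)^{B2−1}] + 1/λ for y₀ < y ≤ y_L is concave on the interval [0, y_L]. -/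
open Set in
/-- A function glued from two pieces with antitone derivatives, whose values and derivatives agree
at the junction, is concave. -/
theorem concaveOn_Icc_ite_of_hasDerivAt {f g f' g' : ℝ → ℝ} {a b d : ℝ}
    (hab : a < b) (hbd : b < d) (hfc : ContinuousOn f (Icc a b))
    (hf : ∀ x ∈ Ioc a b, HasDerivAt f (f' x) x) (hg : ∀ x ∈ Icc b d, HasDerivAt g (g' x) x)
    (hf' : AntitoneOn f' (Ioc a b)) (hg' : AntitoneOn g' (Icc b d))
    (hfg : f b = g b) (hfg' : f' b = g' b) :
    ConcaveOn ℝ (Icc a d) fun x => if x ≤ b then f x else g x := by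
  set h : ℝ → ℝ := fun x => if x ≤ b then f x else g x with hh
  have hl : EqOn h f (Iic b) := fun x hx => if_pos hx
  have hu : EqOn h g (Ici b) := by
    intro x hx
    rcases eq_or_lt_of_le (mem_Ici.1 hx) with rfl | hx
    · simp [hh, hfg]
    · simp [hh, hx]
  have hderiv : ∀ x ∈ Ioo a d, HasDerivAt h (if x ≤ b then f' x else g' x) x := by
    intro x hx
    rcases lt_trichotomy x b with hxb | rfl | hxb
    · rw [if_pos hxb.le]
      exact (hf x ⟨hx.1, hxb.le⟩).congr_of_eventuallyEq
        (hl.eventuallyEq_of_mem (Iic_mem_nhds hxb))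
    · rw [if_pos le_rfl]
      have h1 : HasDerivWithinAt h (f' x) (Iic x) x :=
        (hf x ⟨hx.1, le_rfl⟩).hasDerivWithinAt.congr hl (hl self_mem_Iic)
      have h2 : HasDerivWithinAt h (f' x) (Ici x) x :=
        hfg' ▸ (hg x ⟨le_rfl, hx.2.le⟩).hasDerivWithinAt.congr hu (hu self_mem_Ici)
      simpa using h1.union h2
    · rw [if_neg hxb.not_ge]
      exact (hg x ⟨hxb.le, hx.2.le⟩).congr_of_eventuallyEq
        (hu.eventuallyEq_of_mem (Ici_mem_nhds hxb))
  have hcont : ContinuousOn h (Icc a d) := by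
    rw [← Icc_union_Icc_eq_Icc hab.le hbd.le]
    refine ContinuousOn.union_of_isClosed (hfc.congr (hl.mono Icc_subset_Iic_self)) ?_
      isClosed_Icc isClosed_Icc
    exact ContinuousOn.congr (fun x hx => (hg x hx).continuousAt.continuousWithinAt)
      (hu.mono Icc_subset_Ici_self)
  refine AntitoneOn.concaveOn_of_deriv (convex_Icc a d) hcont ?_ ?_ <;> rw [interior_Icc]
  · exact fun x hx => (hderiv x hx).differentiableAt.differentiableWithinAt
  · intro x hx y hy hxy
    rw [(hderiv x hx).deriv, (hderiv y hy).deriv]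
    split_ifs with hyb hxb hxb
    · exact hf' ⟨hx.1, hxb⟩ ⟨hy.1, hyb⟩ hxy
    · exact absurd (hxy.trans hyb) hxb
    · rw [not_le] at hyb
      calc g' y ≤ g' b := hg' ⟨le_rfl, hbd.le⟩ ⟨hyb.le, hy.2.le⟩ hyb.le
        _ = f' b := hfg'.symm
        _ ≤ f' x := hf' ⟨hx.1, hxb⟩ ⟨hab, le_rfl⟩ hxb
    · exact hg' ⟨(not_le.1 hxb).le, hx.2.le⟩ ⟨(not_le.1 hyb).le, hy.2.le⟩ hxy

theorem hasDerivAt_mul_div_rpow {x k : ℝ} (p : ℝ) (hx : 0 < x) (hk : 0 < k) :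
    HasDerivAt (fun y => y * (y / k) ^ (p - 1)) (p * (x / k) ^ (p - 1)) x := by
  have hxk : 0 < x / k := div_pos hx hk
  have h := (hasDerivAt_id x).mul
    (((hasDerivAt_id x).div_const k).rpow_const (p := p - 1) (Or.inl hxk.ne'))
  refine h.congr_deriv ?_
  simp only [id]
  rw [Real.rpow_sub_one hxk.ne' (p - 1)]
  field_simp
  ring

/-- The piecewise function m̂ (given by the two formulas on [0, y₀] and
(y₀, y_L]) is concave on [0, y_L], under the smooth-fit and value-matching conditions. -/
theorem stmt_7 (B1 B2 c r lam L y0 yL : ℝ) (hB1 : 1 < B1) (hB2 : B2 < 0)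
    (hc : 0 < c) (hr : 0 < r) (hlam : 0 < lam) (hL : 0 < L)
    (hy0 : 0 < y0) (hy0yL : y0 < yL)
    (hsmooth : c / (c + r * L)
      = (B1 * (1 - B2) / (B1 - B2)) * (y0/yL) ^ (B1 - 1)
        + ((B1 - 1) * B2 / (B1 - B2)) * (y0/yL) ^ (B2 - 1))
    (hmatch : (c/r) * y0 * (1 - 1/B1)
      = y0 * (c/r - ((1 - B2)/(B1 - B2)) * (c/r + L) * (y0/yL) ^ (B1 - 1)
                - ((B1 - 1)/(B1 - B2)) * (c/r + L) * (y0/yL) ^ (B2 - 1)) + 1/lam)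
    (mhat : ℝ → ℝ)
    (hmhat : mhat = fun y : ℝ =>
      if y ≤ y0 then (c/r) * y * (1 - (1/B1) * (y/y0) ^ (B1 - 1))
      else y * (c/r - ((1 - B2)/(B1 - B2)) * (c/r + L) * (y/yL) ^ (B1 - 1)
                  - ((B1 - 1)/(B1 - B2)) * (c/r + L) * (y/yL) ^ (B2 - 1)) + 1/lam) :
    ConcaveOn ℝ (Set.Icc 0 yL) mhat := by
  have hyL : 0 < yL := hy0.trans hy0yL
  have hB : 0 < B1 - B2 := by linarith
  have hone : (y0 / y0) ^ (B1 - 1) = 1 := by rw [div_self hy0.ne', Real.one_rpow]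
  rw [hmhat]
  refine concaveOn_Icc_ite_of_hasDerivAt
    (f' := fun y => (c/r) * (1 - (y/y0) ^ (B1 - 1)))
    (g' := fun y => c/r - (c/r + L) * ((B1 * (1 - B2) / (B1 - B2)) * (y/yL) ^ (B1 - 1)
        + ((B1 - 1) * B2 / (B1 - B2)) * (y/yL) ^ (B2 - 1)))
    hy0 hy0yL ?_ ?_ ?_ ?_ ?_ ?_ ?_
  · have : Continuous fun y : ℝ => (y / y0) ^ (B1 - 1) :=
      (continuous_id.div_const y0).rpow_const fun _ => Or.inr (by linarith)
    fun_prop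
  · intro x hx
    have h := ((hasDerivAt_id x).sub
      ((hasDerivAt_mul_div_rpow B1 hx.1 hy0).const_mul (1 / B1))).const_mul (c / r)
    refine (h.congr_deriv ?_).congr_of_eventuallyEq (.of_forall fun y => ?_)
    · field_simp
    · simp only [id, Pi.sub_apply]
      ring
  · intro x hx
    have hx0 : 0 < x := hy0.trans_le hx.1
    have h := ((((hasDerivAt_id x).const_mul (c / r)).sub
      ((hasDerivAt_mul_div_rpow B1 hx0 hyL).const_mul ((1 - B2)/(B1 - B2) * (c/r + L)))).sub
      ((hasDerivAt_mul_div_rpow B2 hx0 hyL).const_mul ((B1 - 1)/(B1 - B2) * (c/r + L)))).add_const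
      (1 / lam)
    refine (h.congr_deriv ?_).congr_of_eventuallyEq (.of_forall fun y => ?_)
    · ring
    · simp only [id, Pi.sub_apply]
      ring
  · intro x hx y _ hxy
    have hx0 : 0 < x := hx.1
    have : (x / y0) ^ (B1 - 1) ≤ (y / y0) ^ (B1 - 1) := by
      gcongr
    dsimp only
    gcongr
  · intro x hx y _ hxy
    have hx0 : 0 < x := hy0.trans_le hx.1
    have h1 : (x / yL) ^ (B1 - 1) ≤ (y / yL) ^ (B1 - 1) := by
      gcongr
    have h2 : (y / yL) ^ (B2 - 1) ≤ (x / yL) ^ (B2 - 1) :=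
      Real.rpow_le_rpow_of_nonpos (by positivity) (by gcongr) (by linarith)
    have hc1 : 0 ≤ B1 * (1 - B2) / (B1 - B2) :=
      div_nonneg (mul_nonneg (by linarith) (by linarith)) hB.le
    have hc2 : (B1 - 1) * B2 / (B1 - B2) ≤ 0 :=
      div_nonpos_of_nonpos_of_nonneg
        (mul_nonpos_of_nonneg_of_nonpos (by linarith) hB2.le) hB.le
    have h3 := mul_le_mul_of_nonneg_left h1 hc1
    have h4 := mul_le_mul_of_nonpos_left h2 hc2
    dsimp only
    gcongr ?_ - _ * ?_
    linarith
  · rw [hone, mul_one]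
    exact hmatch
  · rw [hone, ← hsmooth]
    field_simp
end

section
/- For every y ∈ (0, y_L), the function m̂(y) = y·[c/r − ((1 − B2)/(B1 − B2))·(c/r + L)·(y/y_L)^{B1−1} − ((B1 − 1)/(B1 − B2))·(c/r + L)·(y/y_L)^{B2−1}] + 1/λ satisfies the strict inequality −y·m̂''(y) > (B1 − 1)·(c/r − m̂'(y)). -/
/-- Logarithmic-derivative form of the power rule for `z ↦ (z / b) ^ a`. -/
lemma hasDerivAt_div_rpow {b y : ℝ} (hb : 0 < b) (hy : 0 < y) (a : ℝ) :
    HasDerivAt (fun z : ℝ => (z / b) ^ a) (a * (y / b) ^ a / y) y := by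
  have hyb : 0 < y / b := div_pos hy hb
  refine (((hasDerivAt_id' y).div_const b).rpow_const (p := a) (Or.inl hyb.ne')).congr_deriv ?_
  rw [Real.rpow_sub_one hyb.ne']
  field_simp

lemma hasDerivAt_mul_div_rpow_s8 {b y : ℝ} (hb : 0 < b) (hy : 0 < y) (a : ℝ) :
    HasDerivAt (fun z : ℝ => z * (z / b) ^ a) ((a + 1) * (y / b) ^ a) y := by
  refine ((hasDerivAt_id' y).mul (hasDerivAt_div_rpow hb hy a)).congr_deriv ?_
  field_simp
  ring


/-- For every y ∈ (0, y_L), the function m̂ satisfies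
−y·m̂''(y) > (B1 − 1)·(c/r − m̂'(y)). -/
theorem stmt_8 (B1 B2 c r lam L yL : ℝ) (hB1 : 1 < B1) (hB2 : B2 < 0)
    (hc : 0 < c) (hr : 0 < r) (hlam : 0 < lam) (hL : 0 < L) (hyL : 0 < yL)
    (mhat : ℝ → ℝ)
    (hmhat : mhat = fun y : ℝ =>
      y * (c/r - ((1 - B2)/(B1 - B2)) * (c/r + L) * (y/yL) ^ (B1 - 1)
             - ((B1 - 1)/(B1 - B2)) * (c/r + L) * (y/yL) ^ (B2 - 1)) + 1/lam) :
    ∀ y ∈ Set.Ioo (0:ℝ) yL,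
      -y * deriv (deriv mhat) y > (B1 - 1) * (c/r - deriv mhat y) := by
  rintro y ⟨hy, -⟩
  set K := c / r + L
  have hK : 0 < K := by positivity
  set A := (1 - B2) / (B1 - B2) * K
  set D := (B1 - 1) / (B1 - B2) * K
  have hD : 0 < D := mul_pos (div_pos (by linarith) (by linarith)) hK
  have deriv_mhat : ∀ z : ℝ, 0 < z → deriv mhat z =
      c / r - A * B1 * (z / yL) ^ (B1 - 1) - D * B2 * (z / yL) ^ (B2 - 1) := by
    intro z hz
    have h := ((((hasDerivAt_id z).mul_const (c / r)).sub
      ((hasDerivAt_mul_div_rpow_s8 hyL hz (B1 - 1)).const_mul A)).sub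
      ((hasDerivAt_mul_div_rpow_s8 hyL hz (B2 - 1)).const_mul D)).add_const (1 / lam)
    have hfun : mhat = fun z : ℝ => z * (c / r) - A * (z * (z / yL) ^ (B1 - 1))
        - D * (z * (z / yL) ^ (B2 - 1)) + 1 / lam := by
      rw [hmhat]
      funext z
      ring
    rw [hfun]
    refine (HasDerivAt.deriv h).trans ?_
    ring
  have deriv2_mhat : deriv (deriv mhat) y =
      -(A * B1 * ((B1 - 1) * (y / yL) ^ (B1 - 1) / y))
        - D * B2 * ((B2 - 1) * (y / yL) ^ (B2 - 1) / y) := by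
    have heq : deriv mhat =ᶠ[nhds y] fun z =>
        c / r - A * B1 * (z / yL) ^ (B1 - 1) - D * B2 * (z / yL) ^ (B2 - 1) := by
      filter_upwards [eventually_gt_nhds hy] with z hz using deriv_mhat z hz
    rw [heq.deriv_eq]
    exact ((((hasDerivAt_div_rpow hyL hy (B1 - 1)).const_mul (A * B1)).const_sub (c / r)).sub
      ((hasDerivAt_div_rpow hyL hy (B2 - 1)).const_mul (D * B2))).deriv
  have hq : 0 < (y / yL) ^ (B2 - 1) := Real.rpow_pos_of_pos (div_pos hy hyL) _
  have hpos : 0 < D * (-B2 * (B1 - B2)) * (y / yL) ^ (B2 - 1) :=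
    mul_pos (mul_pos hD (mul_pos (by linarith) (by linarith))) hq
  have hdiff : -y * deriv (deriv mhat) y - (B1 - 1) * (c / r - deriv mhat y) =
      D * (-B2 * (B1 - B2)) * (y / yL) ^ (B2 - 1) := by
    rw [deriv2_mhat, deriv_mhat y hy]
    clear_value A D
    field_simp
    ring
  linarith
end

section
/- For every y ∈ (0, y_L), the function m̂(y) = y·[c/r − ((1 − B2)/(B1 − B2))·(c/r + L)·(y/y_L)^{B1−1} − ((B1 − 1)/(B1 − B2))·(c/r + L)·(y/y_L)^{B2−1}] + 1/λ satisfies: y·m̂'''(y) < −m̂''(y) if and only if B1·(B1 − 1)·(y/y_L)^{B1−B2} + B2·(1 − B2) > 0. -/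
/-- Differentiation on the positive half-line of an affine function plus two scaled powers. -/
theorem deriv_eq_of_eq_affine_add_rpow {f : ℝ → ℝ} {A E C D p q s : ℝ} (hs : 0 < s)
    (hf : ∀ x, 0 < x → f x = A * x + E + (C * (x / s) ^ p + D * (x / s) ^ q)) :
    ∀ x, 0 < x → deriv f x =
      0 * x + A + (C * p / s * (x / s) ^ (p - 1) + D * q / s * (x / s) ^ (q - 1)) := by
  intro x hx
  have hpow (t : ℝ) : HasDerivAt (fun y : ℝ => (y / s) ^ t) (1 / s * t * (x / s) ^ (t - 1)) x :=
    ((hasDerivAt_id x).div_const s).rpow_const (Or.inl (div_pos hx hs).ne')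
  have hsum := (((hasDerivAt_id x).const_mul A).add_const E).add
    (((hpow p).const_mul C).add ((hpow q).const_mul D))
  have heq : f =ᶠ[nhds x] fun y => A * y + E + (C * (y / s) ^ p + D * (y / s) ^ q) := by
    filter_upwards [Ioi_mem_nhds hx] with y hy using hf y hy
  rw [heq.deriv_eq]
  refine hsum.deriv.trans ?_
  ring


/-- For every y ∈ (0, y_L), y·m̂'''(y) < −m̂''(y) if and only if
B1·(B1 − 1)·(y/y_L)^{B1−B2} + B2·(1 − B2) > 0. -/
theorem stmt_10 (B1 B2 c r lam L yL : ℝ) (hB1 : 1 < B1) (hB2 : B2 < 0)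
    (hc : 0 < c) (hr : 0 < r) (hlam : 0 < lam) (hL : 0 < L) (hyL : 0 < yL)
    (mhat : ℝ → ℝ)
    (hmhat : mhat = fun y : ℝ =>
      y * (c/r - ((1 - B2)/(B1 - B2)) * (c/r + L) * (y/yL) ^ (B1 - 1)
             - ((B1 - 1)/(B1 - B2)) * (c/r + L) * (y/yL) ^ (B2 - 1)) + 1/lam) :
    ∀ y ∈ Set.Ioo (0:ℝ) yL,
      (y * deriv (deriv (deriv mhat)) y < -(deriv (deriv mhat) y) ↔
        B1 * (B1 - 1) * (y/yL) ^ (B1 - B2) + B2 * (1 - B2) > 0) := by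
  intro y hy
  have hy0 : 0 < y := hy.1
  have hB : 0 < B1 - B2 := by linarith
  have hK : 0 < c / r + L := by positivity
  have hform : ∀ x, 0 < x → mhat x = c / r * x + 1 / lam +
      (-((1 - B2) / (B1 - B2) * (c / r + L) * yL) * (x / yL) ^ B1 +
        -((B1 - 1) / (B1 - B2) * (c / r + L) * yL) * (x / yL) ^ B2) := by
    intro x hx
    have hu : x / yL ≠ 0 := (div_pos hx hyL).ne'
    rw [hmhat]
    simp only [Real.rpow_sub_one hu]
    field_simp
    ring
  have h1 := deriv_eq_of_eq_affine_add_rpow hyL hform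
  have h2 := deriv_eq_of_eq_affine_add_rpow hyL h1
  have h3 := deriv_eq_of_eq_affine_add_rpow hyL h2
  have hu : 0 < y / yL := div_pos hy0 hyL
  have hsplit : (y / yL) ^ B1 = (y / yL) ^ (B1 - B2) * (y / yL) ^ B2 := by
    rw [← Real.rpow_add hu, sub_add_cancel]
  have hP : 0 < (c / r + L) * ((1 - B2) * (B1 - 1)) / (B1 - B2) * yL / y ^ 2 *
      (y / yL) ^ B2 := by
    have : 0 < 1 - B2 := by linarith
    have : 0 < B1 - 1 := by linarith
    positivity
  have key : y * deriv (deriv (deriv mhat)) y + deriv (deriv mhat) y =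
      -((c / r + L) * ((1 - B2) * (B1 - 1)) / (B1 - B2) * yL / y ^ 2 * (y / yL) ^ B2 *
        (B1 * (B1 - 1) * (y / yL) ^ (B1 - B2) + B2 * (1 - B2))) := by
    rw [h3 y hy0, h2 y hy0]
    simp only [Real.rpow_sub_one hu.ne', hsplit]
    generalize (y / yL) ^ (B1 - B2) = v
    generalize (y / yL) ^ B2 = w
    generalize c / r + L = K
    field_simp
    ring
  rw [gt_iff_lt, ← mul_pos_iff_of_pos_left hP]
  constructor <;> intro h <;> linarith
end

section
/- If r < λ, then B1·(B1 − 1)·z^{B1−B2} + B2·(1 − B2) < 0 for every z ∈ (0, 1]. -/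
/-- If r < λ, then B1·(B1 − 1)·z^{B1−B2} + B2·(1 − B2) < 0
for every z ∈ (0, 1]. -/
theorem stmt_11 (r lam sigma mu : ℝ) (hr : 0 < r) (hlam : 0 < lam) (hsigma : 0 < sigma)
    (hmu : r < mu)
    (delta B1 B2 : ℝ)
    (hdelta : delta = (1/2) * ((mu - r)/sigma)^2)
    (hB1 : B1 = ((r - lam + delta) + Real.sqrt ((r - lam + delta)^2 + 4*delta*lam)) / (2*delta))
    (hB2 : B2 = ((r - lam + delta) - Real.sqrt ((r - lam + delta)^2 + 4*delta*lam)) / (2*delta))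
    (hrlam : r < lam) :
    ∀ z ∈ Set.Ioc (0:ℝ) 1, B1 * (B1 - 1) * z ^ (B1 - B2) + B2 * (1 - B2) < 0 := by
  have hd : 0 < delta := by
    have : 0 < mu - r := sub_pos.mpr hmu
    rw [hdelta]
    positivity
  have hs : delta + lam - r < Real.sqrt ((r - lam + delta)^2 + 4*delta*lam) :=
    Real.lt_sqrt_of_sq_lt (by nlinarith [mul_pos hd hr])
  set s := Real.sqrt ((r - lam + delta)^2 + 4*delta*lam)
  have hB1_gt : 1 < B1 := by
    rw [hB1, lt_div_iff₀ (by positivity)]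
    linarith
  have hdiff : 0 < B1 - B2 := by
    have h : B1 - B2 = s / delta := by
      rw [hB1, hB2]
      field_simp
      ring
    rw [h]
    exact div_pos (by linarith) hd
  have hsum : B1 + B2 - 1 < 0 := by
    have h : B1 + B2 - 1 = (r - lam) / delta := by
      rw [hB1, hB2]
      field_simp
      ring
    rw [h]
    exact div_neg_of_neg_of_pos (by linarith) hd
  rintro z ⟨hz0, hz1⟩
  have hpow : z ^ (B1 - B2) ≤ 1 := Real.rpow_le_one hz0.le hz1 hdiff.le
  have hcoef : 0 ≤ B1 * (B1 - 1) := mul_nonneg (by linarith) (by linarith)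
  calc B1 * (B1 - 1) * z ^ (B1 - B2) + B2 * (1 - B2)
      ≤ B1 * (B1 - 1) + B2 * (1 - B2) :=
        add_le_add_left (mul_le_of_le_one_right hcoef hpow) _
    _ = (B1 - B2) * (B1 + B2 - 1) := by ring
    _ < 0 := mul_neg_of_pos_of_neg hdiff hsum
end

section
/- Define m̂₁(y) = (c/r)·y·(1 − (1/B1)·(y/y₀)^{B1−1}) for y ≥ 0, and set p = B1/(B1 − 1) and β = y₀ / (p·(c/r)^{p−1}). Then for every w with 0 ≤ w < c/r, the supremum of m̂₁(y) − w·y over y ≥ 0 equals β·(c/r − w)^p, and it is attained at y* = y₀·(1 − r·w/c)^{1/(B1−1)}. -/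
/-- For 0 ≤ w < c/r, the supremum over y ≥ 0 of m̂₁(y) − w·y equals
β·(c/r − w)^p with p = B1/(B1−1) and β = y₀/(p·(c/r)^{p−1}), attained at
y* = y₀·(1 − r·w/c)^{1/(B1−1)}. -/
theorem stmt_15 (B1 c r y0 : ℝ) (hB1 : 1 < B1) (hc : 0 < c) (hr : 0 < r) (hy0 : 0 < y0)
    (mhat1 : ℝ → ℝ)
    (hmhat1 : mhat1 = fun y : ℝ => (c/r) * y * (1 - (1/B1) * (y/y0) ^ (B1 - 1)))
    (p beta : ℝ)
    (hp : p = B1 / (B1 - 1))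
    (hbeta : beta = y0 / (p * (c/r) ^ (p - 1))) :
    ∀ w : ℝ, 0 ≤ w → w < c/r →
      (∀ y : ℝ, 0 ≤ y → mhat1 y - w * y ≤ beta * (c/r - w) ^ p) ∧
      mhat1 (y0 * (1 - r * w / c) ^ (1/(B1 - 1)))
          - w * (y0 * (1 - r * w / c) ^ (1/(B1 - 1)))
        = beta * (c/r - w) ^ p := by
  intro w _ hw
  subst hmhat1 hbeta
  have hB : 0 < B1 - 1 := by linarith
  have hB0 : 0 < B1 := by linarith
  have hp0 : 0 < p := by rw [hp]; positivity
  have hp1 : p - 1 = 1 / (B1 - 1) := by rw [hp]; field_simp; ring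
  have hconj : B1.HolderConjugate p := by
    rw [hp]; exact Real.HolderConjugate.conjExponent hB1
  have hK : 0 < c / r := div_pos hc hr
  have hs_eq : r * w / c = w / (c / r) := by field_simp
  rw [hs_eq]
  generalize c / r = K at *
  obtain ⟨s, hs⟩ : ∃ s, s = 1 - w / K := ⟨_, rfl⟩
  have hs0 : 0 < s := by
    rw [hs, sub_pos, div_lt_one hK]; exact hw
  have hw_eq : w = K * (1 - s) := by rw [hs]; field_simp; ring
  have hvalue : y0 / (p * K ^ (p - 1)) * (K - w) ^ p = K * y0 * (s ^ p / p) := by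
    have hKs : K - w = K * s := by rw [hw_eq]; ring
    have hKp : K ^ p = K * K ^ (p - 1) := by
      rw [Real.rpow_sub_one hK.ne']; field_simp
    have hKpos : 0 < K ^ (p - 1) := Real.rpow_pos_of_pos hK _
    rw [hKs, Real.mul_rpow hK.le hs0.le, hKp]
    field_simp
  rw [hvalue, ← hs]
  refine ⟨fun y hy => ?_, ?_⟩
  · obtain ⟨z, hz⟩ : ∃ z, z = y / y0 := ⟨_, rfl⟩
    have hz0 : 0 ≤ z := hz ▸ div_nonneg hy hy0.le
    have hy_eq : y = y0 * z := by rw [hz]; field_simp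
    have hzB : z ^ B1 = z * z ^ (B1 - 1) := by
      rw [← Real.rpow_one_add' hz0 (by linarith)]; congr 1; ring
    have hyoung := Real.young_inequality_of_nonneg hz0 hs0.le hconj
    have hmul := mul_le_mul_of_nonneg_left hyoung (mul_pos hK hy0).le
    rw [hzB] at hmul
    simp only [← hz]
    rw [hy_eq, hw_eq]
    have hrewrite : K * (y0 * z) * (1 - 1 / B1 * z ^ (B1 - 1)) - K * (1 - s) * (y0 * z)
        = K * y0 * (z * s) - K * y0 * (z * z ^ (B1 - 1) / B1) := by ring
    rw [hrewrite]
    linarith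
  · have hpow : (s ^ (1 / (B1 - 1))) ^ (B1 - 1) = s := by
      rw [← Real.rpow_mul hs0.le, one_div_mul_cancel hB.ne', Real.rpow_one]
    have hsp : s ^ p = s * s ^ (1 / (B1 - 1)) := by
      rw [← hp1, Real.rpow_sub_one hs0.ne']; field_simp
    simp only [mul_div_cancel_left₀ _ hy0.ne', hpow]
    rw [hsp, hw_eq, hp]
    field_simp
    ring
end
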